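/- Let V be a finite-dimensional vector space over ℂ and let E, F, H : V →ₗ[ℂ] V be linear endomorphisms satisfying the sl₂ relations H ∘ E − E ∘ H = 2 • E, H ∘ F − F ∘ H = (−2) • F, and E ∘ F − F ∘ E = H. Then for every natural number i, the i-fold composite E^i restricts to a linear isomorphism from ker(H + i • id) onto ker(H − i • id); in particular these two kernels have equal dimension. -/

import Mathlib

section helpers
variable {V : Type*} [AddCommGroup V] [Module ℂ V]

lemma sl2aux_weight (E H : Module.End ℂ V) (c : ℂ) (hHE : H * E - E * H = c • E)
    (μ : ℂ) (w : V) (hw : H w = μ • w) (n : ℕ) :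
    H ((E ^ n) w) = (μ + c * n) • (E ^ n) w := by
  induction n with
  | zero => simpa using hw
  | succ n ih =>
    have h := LinearMap.congr_fun hHE ((E ^ n) w)
    simp only [LinearMap.sub_apply, Module.End.mul_apply, LinearMap.smul_apply, ih, map_smul] at h
    rw [pow_succ', Module.End.mul_apply, sub_eq_iff_eq_add.mp h, ← add_smul]
    congr 1
    push_cast
    ring

lemma sl2aux_comm (E F H : Module.End ℂ V) (hHE : H * E - E * H = (2 : ℂ) • E)
    (hEF : E * F - F * E = H)
    (μ : ℂ) (w : V) (hw : H w = μ • w) (k : ℕ) :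
    (E ^ (k + 1)) (F w) = F ((E ^ (k + 1)) w) + (((k : ℂ) + 1) * (μ + k)) • (E ^ k) w := by
  have key : ∀ v, E (F v) = F (E v) + H v := fun v => by
    have h := LinearMap.congr_fun hEF v
    simp only [LinearMap.sub_apply, Module.End.mul_apply] at h
    rw [← h]; abel
  induction k with
  | zero => simp [key, hw]
  | succ k ih =>
    rw [pow_succ', Module.End.mul_apply, ih, map_add, key, map_smul,
      sl2aux_weight E H 2 hHE μ w hw, ← Module.End.mul_apply E, ← Module.End.mul_apply E,
      ← pow_succ', ← pow_succ', add_assoc, ← add_smul]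
    congr 2
    push_cast
    ring

lemma sl2aux_nil [FiniteDimensional ℂ V] (F H : Module.End ℂ V)
    (hHF : H * F - F * H = (-2 : ℂ) • F)
    (μ : ℂ) (w : V) (hw : H w = μ • w) : ∃ n : ℕ, (F ^ n) w = 0 := by
  by_contra! contra
  have hinj : Function.Injective (fun n : ℕ => μ + (-2) * (n : ℂ)) := fun a b h => by
    simpa using h
  have hli := Module.End.eigenvectors_linearIndependent' H (fun n : ℕ => μ + (-2) * (n : ℂ)) hinj
    (fun n => (F ^ n) w)
    (fun n => Module.End.hasEigenvector_iff.mpr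
      ⟨Module.End.mem_eigenspace_iff.mpr (sl2aux_weight F H (-2) hHF μ w hw n), contra n⟩)
  exact not_finite_iff_infinite.mpr (inferInstance : Infinite ℕ) hli.finite

lemma sl2aux_inj (E F H : Module.End ℂ V) (hHE : H * E - E * H = (2 : ℂ) • E)
    (hHF : H * F - F * H = (-2 : ℂ) • F) (hEF : E * F - F * E = H) (N : ℕ) :
    ∀ (k : ℕ) (m : ℤ) (w : V), H w = (m : ℂ) • w → (E ^ k) w = 0 → m + k ≤ 0 →
      (F ^ N) w = 0 → w = 0 := by
  induction N with
  | zero => intro k m w _ _ _ h; simpa using h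
  | succ N ihN =>
    intro k
    induction k with
    | zero => intro m w _ h _ _; simpa using h
    | succ k ihk =>
      intro m w hw hE hm hF
      have h2 : (E ^ (k + 2)) (F w) = 0 := by
        rw [sl2aux_comm E F H hHE hEF m w hw, pow_succ' E (k + 1), Module.End.mul_apply, hE]
        simp
      have hFw : F w = 0 := by
        refine ihN (k + 2) (m - 2) (F w) ?_ h2 (by push_cast at *; omega) ?_
        · have := sl2aux_weight F H (-2) hHF m w hw 1
          simp only [pow_one] at this
          rw [this]; congr 1; push_cast; ring
        · rwa [← Module.End.mul_apply, ← pow_succ]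
      have h1 := sl2aux_comm E F H hHE hEF m w hw k
      rw [hFw, hE, map_zero, map_zero, zero_add, eq_comm, smul_eq_zero] at h1
      refine ihk m w hw (h1.resolve_left ?_) (by push_cast at *; omega) hF
      have : (((k : ℤ) + 1) * (m + k)) ≠ 0 :=
        mul_ne_zero (by omega) (by push_cast at *; omega)
      exact_mod_cast this

lemma sl2aux_map [FiniteDimensional ℂ V] (E F H : Module.End ℂ V)
    (hHE : H * E - E * H = (2 : ℂ) • E)
    (hHF : H * F - F * H = (-2 : ℂ) • F) (hEF : E * F - F * E = H) (i : ℕ) :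
    ∃ g : LinearMap.ker (H + (i : ℂ) • (1 : Module.End ℂ V)) →ₗ[ℂ]
             LinearMap.ker (H - (i : ℂ) • (1 : Module.End ℂ V)),
      Function.Injective g ∧ ∀ x, (g x : V) = (E ^ i) (x : V) := by
  have hk : ∀ x ∈ LinearMap.ker (H + (i : ℂ) • (1 : Module.End ℂ V)),
      H x = (-(i : ℂ)) • x := fun x hx => by
    rw [neg_smul]
    exact eq_neg_of_add_eq_zero_left (by simpa using hx)
  refine ⟨(E ^ i).restrict (fun x hx => ?_), ?_, fun x => rfl⟩
  · have := sl2aux_weight E H 2 hHE _ x (hk x hx) i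
    rw [LinearMap.mem_ker, LinearMap.sub_apply, this, LinearMap.smul_apply, Module.End.one_apply,
      ← sub_smul]
    ring_nf
    simp
  · rw [← LinearMap.ker_eq_bot, LinearMap.ker_eq_bot']
    intro x hx
    have hx' : (E ^ i) (x : V) = 0 := congrArg Subtype.val hx
    obtain ⟨N, hN⟩ := sl2aux_nil F H hHF _ x.1 (hk x.1 x.2)
    exact Subtype.ext (sl2aux_inj E F H hHE hHF hEF N i (-i) x.1
      (by simpa using hk x.1 x.2) hx' (by omega) hN)

end helpers

/-- sl₂-representation theory behind hard Lefschetz: if `E`, `F`, `H` are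
endomorphisms of a finite dimensional complex vector space with
`[H,E] = 2E`, `[H,F] = -2F`, `[E,F] = H`, then for every `i : ℕ` the map
`E^i` restricts to a linear isomorphism from `ker (H + i • id)` (the `(-i)`-
weight space) onto `ker (H - i • id)` (the `i`-weight space); in particular
these kernels have the same dimension. -/
theorem sl2_power_weight_space_iso
    {V : Type*} [AddCommGroup V] [Module ℂ V] [FiniteDimensional ℂ V]
    (E F H : Module.End ℂ V)
    (hHE : H * E - E * H = (2 : ℂ) • E)
    (hHF : H * F - F * H = (-2 : ℂ) • F)
    (hEF : E * F - F * E = H) :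
    ∀ i : ℕ,
      (∃ e : LinearMap.ker (H + (i : ℂ) • (1 : Module.End ℂ V)) ≃ₗ[ℂ]
             LinearMap.ker (H - (i : ℂ) • (1 : Module.End ℂ V)),
        ∀ x, (e x : V) = (E ^ i) (x : V)) ∧
      Module.finrank ℂ (LinearMap.ker (H + (i : ℂ) • (1 : Module.End ℂ V))) =
        Module.finrank ℂ (LinearMap.ker (H - (i : ℂ) • (1 : Module.End ℂ V))) := by
  intro i
  obtain ⟨g, hg, hgE⟩ := sl2aux_map E F H hHE hHF hEF i
  obtain ⟨g', hg', -⟩ := sl2aux_map F E (-H)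
    (by rw [neg_mul, mul_neg, ← neg_sub', hHF, neg_smul, neg_neg])
    (by rw [neg_mul, mul_neg, ← neg_sub', hHE, neg_smul])
    (by rw [← hEF, neg_sub]) i
  have e1 : LinearMap.ker (-H + (i : ℂ) • (1 : Module.End ℂ V)) =
      LinearMap.ker (H - (i : ℂ) • (1 : Module.End ℂ V)) := by
    rw [← LinearMap.ker_neg]; congr 1; abel
  have e2 : LinearMap.ker (-H - (i : ℂ) • (1 : Module.End ℂ V)) =
      LinearMap.ker (H + (i : ℂ) • (1 : Module.End ℂ V)) := by
    rw [← LinearMap.ker_neg]; congr 1; abel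
  have l1 := LinearMap.finrank_le_finrank_of_injective hg
  have l2 := LinearMap.finrank_le_finrank_of_injective hg'
  rw [e1, e2] at l2
  have hd := le_antisymm l1 l2
  exact ⟨⟨LinearEquiv.ofInjectiveOfFinrankEq g hg hd, fun x => hgE x⟩, hd⟩
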